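/- For every integer i > 0, there exists a hole v on the board Rhombus(6i) and a solution to the single-vacancy peg solitaire problem with vacancy v whose last move is a sweep of length (9i−1)(3i−1). -/

import Mathlib

/-- The six jump directions on the triangular lattice (oblique coordinates). -/
def Dirs : Finset (ℤ × ℤ) := {(1,0), (-1,0), (0,1), (0,-1), (1,1), (-1,-1)}

/-- The rhombus board of side `n`: `{0,…,n−1} × {0,…,n−1}`. -/
noncomputable def Rhombus (n : ℕ) : Finset (ℤ × ℤ) :=
  Finset.Icc (0 : ℤ) ((n : ℤ) - 1) ×ˢ Finset.Icc (0 : ℤ) ((n : ℤ) - 1)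

/-- A jump in position `P` on board `B`: peg at `p`, direction `d ∈ Dirs`,
peg at `p+d`, empty board hole at `p+2d`. -/
def JumpOK (B P : Finset (ℤ × ℤ)) (p d : ℤ × ℤ) : Prop :=
  d ∈ Dirs ∧ p ∈ P ∧ p + d ∈ P ∧ p + d + d ∈ B ∧ p + d + d ∉ P

/-- The position resulting from the jump `(p, d)` in position `P`. -/
def jumpResult (P : Finset (ℤ × ℤ)) (p d : ℤ × ℤ) : Finset (ℤ × ℤ) :=
  (P \ {p, p + d}) ∪ {p + d + d}

/-- `SweepFrom B P s ds e Q`: starting in position `P`, the peg at `s` makes the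
consecutive jumps with directions `ds` (each jump starting where the previous landed),
ending at hole `e` and producing position `Q`.  A move is such a sweep with `ds ≠ []`;
its length (number of pegs captured) is `ds.length`. -/
inductive SweepFrom (B : Finset (ℤ × ℤ)) :
    Finset (ℤ × ℤ) → ℤ × ℤ → List (ℤ × ℤ) → ℤ × ℤ → Finset (ℤ × ℤ) → Prop
  | nil (P : Finset (ℤ × ℤ)) (s : ℤ × ℤ) : SweepFrom B P s [] s P
  | cons {P : Finset (ℤ × ℤ)} {s d e : ℤ × ℤ} {ds : List (ℤ × ℤ)} {Q : Finset (ℤ × ℤ)} :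
      JumpOK B P s d → SweepFrom B (jumpResult P s d) (s + d + d) ds e Q →
      SweepFrom B P s (d :: ds) e Q

/-- A move is recorded as a pair (starting hole, nonempty list of jump directions).
`PlayMove B P m Q` says the move `m` is legal in position `P` and produces `Q`. -/
def PlayMove (B P : Finset (ℤ × ℤ)) (m : (ℤ × ℤ) × List (ℤ × ℤ))
    (Q : Finset (ℤ × ℤ)) : Prop :=
  m.2 ≠ [] ∧ ∃ e, SweepFrom B P m.1 m.2 e Q

/-- `Plays B P ms Q`: the finite sequence of moves `ms` leads from position `P`
to position `Q` on board `B`. -/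
inductive Plays (B : Finset (ℤ × ℤ)) :
    Finset (ℤ × ℤ) → List ((ℤ × ℤ) × List (ℤ × ℤ)) → Finset (ℤ × ℤ) → Prop
  | nil (P : Finset (ℤ × ℤ)) : Plays B P [] P
  | cons {P Q R : Finset (ℤ × ℤ)} {m : (ℤ × ℤ) × List (ℤ × ℤ)}
      {ms : List ((ℤ × ℤ) × List (ℤ × ℤ))} :
      PlayMove B P m Q → Plays B Q ms R → Plays B P (m :: ms) R

/-- The list of all holes touched by a sweep starting at `s` with directions `ds`:
every starting hole, every jumped-over hole and every landing hole. -/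
def sweepHoles (s : ℤ × ℤ) : List (ℤ × ℤ) → List (ℤ × ℤ)
  | [] => [s]
  | d :: ds => s :: (s + d) :: sweepHoles (s + d + d) ds

/-- The hole where a sweep starting at `s` with directions `ds` ends. -/
def sweepEnd (s : ℤ × ℤ) : List (ℤ × ℤ) → ℤ × ℤ
  | [] => s
  | d :: ds => sweepEnd (s + d + d) ds

/-- A single jump as a step relation between positions on board `B`. -/
def JumpStep (B P Q : Finset (ℤ × ℤ)) : Prop :=
  ∃ p d, JumpOK B P p d ∧ Q = jumpResult P p d

/-- `BoxRun lo hi S js T`: the jumps `js` lead from `S` to `T`, every landing hole lying in the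
box with opposite corners `lo` and `hi`. -/
def BoxRun (lo hi : ℤ × ℤ) :
    Finset (ℤ × ℤ) → List ((ℤ × ℤ) × (ℤ × ℤ)) → Finset (ℤ × ℤ) → Prop
  | S, [], T => S = T
  | S, (p, d) :: js, T =>
      (d ∈ Dirs ∧ p ∈ S ∧ p + d ∈ S ∧ p + d + d ∉ S ∧ lo.1 ≤ (p + d + d).1 ∧
        (p + d + d).1 ≤ hi.1 ∧ lo.2 ≤ (p + d + d).2 ∧ (p + d + d).2 ≤ hi.2) ∧
      BoxRun lo hi (jumpResult S p d) js T

instance BoxRun.decidable (lo hi : ℤ × ℤ) :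
    ∀ S js T, Decidable (BoxRun lo hi S js T)
  | S, [], T => inferInstanceAs (Decidable (S = T))
  | S, (p, d) :: js, T =>
      haveI := BoxRun.decidable lo hi (jumpResult S p d) js T
      inferInstanceAs (Decidable ((d ∈ Dirs ∧ p ∈ S ∧ p + d ∈ S ∧ p + d + d ∉ S ∧
        lo.1 ≤ (p + d + d).1 ∧ (p + d + d).1 ≤ hi.1 ∧ lo.2 ≤ (p + d + d).2 ∧
        (p + d + d).2 ≤ hi.2) ∧ BoxRun lo hi (jumpResult S p d) js T))

/-- `Reaches B f g`: from the position with characteristic predicate `f`, single jumps on `B`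
lead to the position with characteristic predicate `g`. -/
def Reaches (B : Finset (ℤ × ℤ)) (f g : ℤ × ℤ → Prop) : Prop :=
  ∀ P : Finset (ℤ × ℤ), (∀ z, z ∈ P ↔ f z) →
    ∃ Q : Finset (ℤ × ℤ), (∀ z, z ∈ Q ↔ g z) ∧ Relation.ReflTransGen (JumpStep B) P Q

theorem Reaches.of_iff {B : Finset (ℤ × ℤ)} {f g : ℤ × ℤ → Prop} (h : ∀ z, f z ↔ g z) :
    Reaches B f g :=
  fun P hP => ⟨P, fun z => (hP z).trans (h z), .refl⟩

theorem Reaches.trans {B : Finset (ℤ × ℤ)} {f g h : ℤ × ℤ → Prop} (hfg : Reaches B f g)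
    (hgh : Reaches B g h) : Reaches B f h := by
  intro P hP
  obtain ⟨Q, hQ, hPQ⟩ := hfg P hP
  obtain ⟨R, hR, hQR⟩ := hgh Q hQ
  exact ⟨R, hR, hPQ.trans hQR⟩

theorem mem_jumpResult {P : Finset (ℤ × ℤ)} {p d z : ℤ × ℤ} :
    z ∈ jumpResult P p d ↔ (z ∈ P ∧ z ≠ p ∧ z ≠ p + d) ∨ z = p + d + d := by
  simp [jumpResult, or_comm]

theorem reaches_jump {B : Finset (ℤ × ℤ)} {f : ℤ × ℤ → Prop} {p d : ℤ × ℤ} (hd : d ∈ Dirs)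
    (h₀ : f p) (h₁ : f (p + d)) (h₂ : ¬ f (p + d + d)) (hB : p + d + d ∈ B) :
    Reaches B f (fun z => (f z ∧ z ≠ p ∧ z ≠ p + d) ∨ z = p + d + d) := by
  intro P hP
  refine ⟨jumpResult P p d, fun z => by rw [mem_jumpResult, hP], .single ⟨p, d, ?_, rfl⟩⟩
  exact ⟨hd, (hP _).2 h₀, (hP _).2 h₁, hB, fun h => h₂ ((hP _).1 h)⟩

theorem reaches_line {B : Finset (ℤ × ℤ)} {g : ℤ × ℤ → Prop} {d : ℤ × ℤ} (hd : d ∈ Dirs) (m : ℕ) :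
    ∀ (f : ℤ × ℤ → Prop) (s : ℤ × ℤ),
      (∀ t : ℤ, 0 ≤ t → t ≤ 2 * m → (f (s + t • d) ↔ t = 0 ∨ t % 2 = 1)) →
      (∀ t : ℤ, 0 ≤ t → t ≤ 2 * m → (g (s + t • d) ↔ t = 2 * m)) →
      (∀ z, (∀ t : ℤ, 0 ≤ t → t ≤ 2 * m → z ≠ s + t • d) → (f z ↔ g z)) →
      (∀ t : ℤ, 0 < t → t ≤ 2 * m → s + t • d ∈ B) → Reaches B f g := by
  have hd0 : d ≠ 0 := by rintro rfl; revert hd; decide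
  have hinj : ∀ (s : ℤ × ℤ) (t u : ℤ), s + t • d = s + u • d ↔ t = u := fun s t u => by
    rw [add_right_inj]; exact (smul_left_injective ℤ hd0).eq_iff
  induction m with
  | zero =>
    intro f s hf hg hout _
    refine Reaches.of_iff fun z => ?_
    by_cases hz : z = s
    · have h1 := hf 0 le_rfl (by simp)
      have h2 := hg 0 le_rfl (by simp)
      simp only [zero_smul, add_zero] at h1 h2
      subst hz; simp [h1, h2]
    · refine hout z fun t h0 h1 => ?_
      obtain rfl : t = 0 := by push_cast at h1; omega
      simpa using hz
  | succ m ih =>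
    intro f s hf hg hout hB
    push_cast at hf hg hout hB
    have e1 : s + d = s + (1 : ℤ) • d := by simp
    have e2 : s + d + d = s + (2 : ℤ) • d := by rw [two_smul, add_assoc]
    have shift : ∀ t : ℤ, s + d + d + t • d = s + (t + 2) • d := fun t => by
      rw [e2, add_smul]; abel
    refine (reaches_jump (p := s) hd ?_ ?_ ?_ ?_).trans (ih _ (s + d + d) ?_ ?_ ?_ ?_)
    · have := hf 0 le_rfl (by omega)
      simpa using this
    · rw [e1, hf 1 (by omega) (by omega)]; omega
    · rw [e2, hf 2 (by omega) (by omega)]; omega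
    · rw [e2]; exact hB 2 (by omega) (by omega)
    · intro t h0 h1
      have h3 : s + (t + 2) • d ≠ s := by
        intro h; rw [add_eq_left] at h
        rcases smul_eq_zero.1 h with h | h
        · omega
        · exact hd0 h
      rw [shift, hf _ (by omega) (by omega), e2, e1]
      simp only [ne_eq, hinj, h3, not_false_eq_true, true_and]
      omega
    · intro t h0 h1
      rw [shift, hg _ (by omega) (by omega)]; omega
    · intro z hz
      have hz2 : z ≠ s + d + d := by simpa using hz 0 le_rfl (by omega)
      by_cases h0 : z = s
      · have := hg 0 le_rfl (by omega)
        simp only [zero_smul, add_zero] at this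
        rw [h0, this]
        rw [h0] at hz2
        simp only [hz2, ne_eq, not_true_eq_false, false_and, and_false, or_self, false_iff]
        omega
      by_cases h1 : z = s + d
      · rw [h1] at hz2
        have := hg 1 (by omega) (by omega)
        rw [h1, e1, this]
        rw [e1] at hz2
        simp only [hz2, ne_eq, not_true_eq_false, and_false, or_self, false_iff]
        omega
      simp only [h0, h1, hz2, ne_eq, not_false_eq_true, and_true, or_false]
      refine hout z fun t ht0 ht1 h => ?_
      by_cases ht : t < 2
      · obtain rfl | rfl : t = 0 ∨ t = 1 := by omega
        · exact h0 (by simpa using h)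
        · exact h1 (by simpa using h)
      · refine hz (t - 2) (by omega) (by omega) ?_
        rw [shift, h]; congr 2; ring
    · intro t h0 h1
      rw [shift]; exact hB _ (by omega) (by omega)

theorem mem_Rhombus {n : ℕ} {x y : ℤ} :
    (x, y) ∈ Rhombus n ↔ (0 ≤ x ∧ x ≤ n - 1) ∧ 0 ≤ y ∧ y ≤ n - 1 := by
  simp [Rhombus]

theorem reaches_left {n : ℕ} {f g : ℤ × ℤ → Prop} {a b y : ℤ} (hab : a ≤ b)
    (hpar : (b - a) % 2 = 0) (ha : 0 ≤ a) (hb : b ≤ n - 1) (hy : 0 ≤ y) (hy' : y ≤ n - 1)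
    (hf : ∀ x, a ≤ x → x ≤ b → (f (x, y) ↔ x = b ∨ (x - a) % 2 = 1))
    (hg : ∀ x, a ≤ x → x ≤ b → (g (x, y) ↔ x = a))
    (hout : ∀ x z, (z ≠ y ∨ x < a ∨ b < x) → (f (x, z) ↔ g (x, z))) :
    Reaches (Rhombus n) f g := by
  have e : ∀ t : ℤ, ((b, y) : ℤ × ℤ) + t • ((-1, 0) : ℤ × ℤ) = (b - t, y) := fun t => by
    simp [sub_eq_add_neg]
  have hm : (2 * ((b - a) / 2).toNat : ℤ) = b - a := by omega
  refine reaches_line (d := (-1, 0)) (by decide) ((b - a) / 2).toNat f (b, y) ?_ ?_ ?_ ?_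
  · intro t h0 h1; rw [e, hf _ (by omega) (by omega)]; omega
  · intro t h0 h1; rw [e, hg _ (by omega) (by omega)]; omega
  · rintro ⟨x, z⟩ h
    refine hout x z ?_
    by_contra hc
    refine h (b - x) (by omega) (by omega) ?_
    rw [e, Prod.mk.injEq]; omega
  · intro t h0 h1; rw [e, mem_Rhombus]; omega

theorem reaches_down {n : ℕ} {f g : ℤ × ℤ → Prop} {a b x : ℤ} (hab : a ≤ b)
    (hpar : (b - a) % 2 = 0) (ha : 0 ≤ a) (hb : b ≤ n - 1) (hx : 0 ≤ x) (hx' : x ≤ n - 1)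
    (hf : ∀ y, a ≤ y → y ≤ b → (f (x, y) ↔ y = b ∨ (y - a) % 2 = 1))
    (hg : ∀ y, a ≤ y → y ≤ b → (g (x, y) ↔ y = a))
    (hout : ∀ z y, (z ≠ x ∨ y < a ∨ b < y) → (f (z, y) ↔ g (z, y))) :
    Reaches (Rhombus n) f g := by
  have e : ∀ t : ℤ, ((x, b) : ℤ × ℤ) + t • ((0, -1) : ℤ × ℤ) = (x, b - t) := fun t => by
    simp [sub_eq_add_neg]
  have hm : (2 * ((b - a) / 2).toNat : ℤ) = b - a := by omega
  refine reaches_line (d := (0, -1)) (by decide) ((b - a) / 2).toNat f (x, b) ?_ ?_ ?_ ?_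
  · intro t h0 h1; rw [e, hf _ (by omega) (by omega)]; omega
  · intro t h0 h1; rw [e, hg _ (by omega) (by omega)]; omega
  · rintro ⟨z, y⟩ h
    refine hout z y ?_
    by_contra hc
    refine h (b - y) (by omega) (by omega) ?_
    rw [e, Prod.mk.injEq]; omega
  · intro t h0 h1; rw [e, mem_Rhombus]; omega

theorem reaches_up {n : ℕ} {f g : ℤ × ℤ → Prop} {a b x : ℤ} (hab : a ≤ b)
    (hpar : (b - a) % 2 = 0) (ha : 0 ≤ a) (hb : b ≤ n - 1) (hx : 0 ≤ x) (hx' : x ≤ n - 1)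
    (hf : ∀ y, a ≤ y → y ≤ b → (f (x, y) ↔ y = a ∨ (y - a) % 2 = 1))
    (hg : ∀ y, a ≤ y → y ≤ b → (g (x, y) ↔ y = b))
    (hout : ∀ z y, (z ≠ x ∨ y < a ∨ b < y) → (f (z, y) ↔ g (z, y))) :
    Reaches (Rhombus n) f g := by
  have e : ∀ t : ℤ, ((x, a) : ℤ × ℤ) + t • ((0, 1) : ℤ × ℤ) = (x, a + t) := fun t => by
    ext <;> simp
  have hm : (2 * ((b - a) / 2).toNat : ℤ) = b - a := by omega
  refine reaches_line (d := (0, 1)) (by decide) ((b - a) / 2).toNat f (x, a) ?_ ?_ ?_ ?_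
  · intro t h0 h1; rw [e, hf _ (by omega) (by omega)]; omega
  · intro t h0 h1; rw [e, hg _ (by omega) (by omega)]; omega
  · rintro ⟨z, y⟩ h
    refine hout z y ?_
    by_contra hc
    refine h (y - a) (by omega) (by omega) ?_
    rw [e, Prod.mk.injEq]; omega
  · intro t h0 h1; rw [e, mem_Rhombus]; omega

theorem BoxRun.reaches {B : Finset (ℤ × ℤ)} {lo hi o : ℤ × ℤ} {g : ℤ × ℤ → Prop}
    (hB : ∀ x y, lo.1 ≤ x → x ≤ hi.1 → lo.2 ≤ y → y ≤ hi.2 → (x, y) + o ∈ B)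
    {T : Finset (ℤ × ℤ)} (js : List ((ℤ × ℤ) × (ℤ × ℤ))) :
    ∀ (f : ℤ × ℤ → Prop) (S : Finset (ℤ × ℤ)), BoxRun lo hi S js T →
      (∀ z ∈ S, lo.1 ≤ z.1 ∧ z.1 ≤ hi.1 ∧ lo.2 ≤ z.2 ∧ z.2 ≤ hi.2) →
      (∀ x y, lo.1 ≤ x → x ≤ hi.1 → lo.2 ≤ y → y ≤ hi.2 → (f ((x, y) + o) ↔ (x, y) ∈ S)) →
      (∀ x y, lo.1 ≤ x → x ≤ hi.1 → lo.2 ≤ y → y ≤ hi.2 → (g ((x, y) + o) ↔ (x, y) ∈ T)) →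
      (∀ x y, ¬ (lo.1 ≤ x ∧ x ≤ hi.1 ∧ lo.2 ≤ y ∧ y ≤ hi.2) →
        (f ((x, y) + o) ↔ g ((x, y) + o))) →
      Reaches B f g := by
  induction js with
  | nil =>
    intro f S hrun _ hf hg hout
    obtain rfl : S = T := hrun
    refine Reaches.of_iff fun z => ?_
    have hz : z = ((z - o).1, (z - o).2) + o := (sub_add_cancel z o).symm
    rw [hz]
    by_cases h : lo.1 ≤ (z - o).1 ∧ (z - o).1 ≤ hi.1 ∧ lo.2 ≤ (z - o).2 ∧ (z - o).2 ≤ hi.2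
    · obtain ⟨h1, h2, h3, h4⟩ := h
      rw [hf _ _ h1 h2 h3 h4, hg _ _ h1 h2 h3 h4]
    · exact hout _ _ h
  | cons j js ih =>
    obtain ⟨p, d⟩ := j
    rintro f S ⟨⟨hd, hp, hpd, hpdd, h1, h2, h3, h4⟩, hrun⟩ hS hf hg hout
    have hmem : ∀ z ∈ S, f (z + o) := fun z hz => by
      obtain ⟨a, b, c, e⟩ := hS z hz
      exact (hf z.1 z.2 a b c e).2 hz
    have e1 : p + o + d = p + d + o := by abel
    have e2 : p + o + d + d = p + d + d + o := by abel
    have e3 : p + d + o + d = p + d + d + o := by abel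
    refine (reaches_jump (p := p + o) hd (hmem p hp) ?_ ?_ ?_).trans
      (ih _ (jumpResult S p d) hrun ?_ ?_ hg ?_)
    · rw [e1]; exact hmem _ hpd
    · rw [e2]; exact fun h => hpdd ((hf _ _ h1 h2 h3 h4).1 h)
    · rw [e2]; exact hB _ _ h1 h2 h3 h4
    · intro z hz
      rcases mem_jumpResult.1 hz with hz | rfl
      · exact hS z hz.1
      · exact ⟨h1, h2, h3, h4⟩
    · intro x y a b c e
      simp only [mem_jumpResult, hf x y a b c e, e1, e3, ne_eq, add_left_inj]
    · intro x y hxy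
      have key : ∀ w : ℤ × ℤ, lo.1 ≤ w.1 → w.1 ≤ hi.1 → lo.2 ≤ w.2 → w.2 ≤ hi.2 → (x, y) ≠ w := by
        rintro w a b c e rfl; exact hxy ⟨a, b, c, e⟩
      obtain ⟨a, b, c, e⟩ := hS _ hp
      obtain ⟨a', b', c', e'⟩ := hS _ hpd
      simp only [e1, e3, add_left_inj, key p a b c e, key _ a' b' c' e', key _ h1 h2 h3 h4, ne_eq,
        not_false_eq_true, and_true, or_false]
      exact hout x y hxy

/-- The part of the position that a reduction step in the band from `c` to `c + 6` never
touches. -/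
def core (W c : ℤ) (z : ℤ × ℤ) : Prop :=
  (z.1 % 2 = 0 ∧ z.2 % 2 = 0 ∧ c + 6 ≤ z.1 ∧ z.1 < W ∧ c + 6 ≤ z.2 ∧ z.2 < W) ∨
    (z.1 = W ∧ c + 6 ≤ z.2 ∧ z.2 ≤ W) ∨ (z.2 = W ∧ c + 6 < z.1 ∧ z.1 ≤ W) ∨
    (z.1 = W ∧ z.2 % 2 = 1 ∧ 0 ≤ z.2 ∧ z.2 < c + 6)

/-- The peg left behind by the reduction of the preceding band. -/
def leftover (c : ℤ) (z : ℤ × ℤ) : Prop :=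
  0 < c ∧ z.1 = c - 1 ∧ z.2 = c - 2

/-- The position reached once all bands below `c` are reduced. -/
def stage (W c : ℤ) (z : ℤ × ℤ) : Prop :=
  (z.1 % 2 = 0 ∧ z.2 % 2 = 0 ∧ c ≤ z.1 ∧ z.1 < W ∧ c ≤ z.2 ∧ z.2 < W ∧
      (c = 0 → ¬ (z.1 = 0 ∧ z.2 = 0))) ∨
    (z.1 = W ∧ c ≤ z.2 ∧ z.2 ≤ W) ∨ (z.2 = W ∧ c ≤ z.1 ∧ z.1 ≤ W) ∨
    (z.1 = W ∧ z.2 % 2 = 1 ∧ 0 ≤ z.2 ∧ z.2 < c) ∨ leftover c z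

/-- The band after `r` of its three rows have been swept to the left. -/
def rowsSwept (W c r : ℤ) (z : ℤ × ℤ) : Prop :=
  (z.1 % 2 = 0 ∧ z.2 % 2 = 0 ∧ c ≤ z.1 ∧ z.1 < W ∧ c ≤ z.2 ∧ z.2 < W ∧
      (z.1 < c + 6 ∨ (c + 2 * r ≤ z.2 ∧ z.2 < c + 6)) ∧ (c = 0 → ¬ (z.1 = 0 ∧ z.2 = 0))) ∨
    (z.1 = W ∧ z.2 % 2 = 0 ∧ c + 2 * r ≤ z.2 ∧ z.2 < c + 6) ∨
    (z.1 = c + 5 ∧ z.2 % 2 = 0 ∧ c ≤ z.2 ∧ z.2 < c + 2 * r) ∨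
    (z.2 = W ∧ c ≤ z.1 ∧ z.1 ≤ c + 6) ∨ leftover c z

/-- The band after the jumps in its top left corner. -/
def topDone (W c : ℤ) (z : ℤ × ℤ) : Prop :=
  (z.1 % 2 = 0 ∧ z.2 % 2 = 0 ∧ c ≤ z.1 ∧ z.1 < c + 6 ∧ c ≤ z.2 ∧ z.2 < W ∧
      (z.1 = c + 4 → z.2 < W - 1) ∧ (c = 0 → ¬ (z.1 = 0 ∧ z.2 = 0))) ∨
    (z.1 = c + 5 ∧ z.2 % 2 = 0 ∧ c ≤ z.2 ∧ z.2 < c + 6) ∨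
    (z.2 = W ∧ (z.1 = c ∨ z.1 = c + 3 ∨ z.1 = c + 5)) ∨ (z.1 = c + 4 ∧ z.2 = W - 2) ∨
    leftover c z

/-- The band after its leftmost column has been swept down. -/
def leftDone (W c : ℤ) (z : ℤ × ℤ) : Prop :=
  (z.1 % 2 = 0 ∧ z.2 % 2 = 0 ∧ c ≤ z.1 ∧ z.1 < c + 6 ∧ c ≤ z.2 ∧ z.2 < W ∧
      (z.1 = c → z.2 < c + 6) ∧
      (z.1 = c + 4 → z.2 < W - 1) ∧ (c = 0 → ¬ (z.1 = 0 ∧ z.2 = 0))) ∨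
    (z.1 = c + 5 ∧ z.2 % 2 = 0 ∧ c ≤ z.2 ∧ z.2 < c + 6) ∨ (z.1 = c ∧ z.2 = c + 5) ∨
    (z.2 = W ∧ (z.1 = c + 3 ∨ z.1 = c + 5)) ∨ (z.1 = c + 4 ∧ z.2 = W - 2) ∨ leftover c z

/-- The band after its columns `c` and `c + 4` have been swept down. -/
def columnsDone (W c : ℤ) (z : ℤ × ℤ) : Prop :=
  (z.1 % 2 = 0 ∧ z.2 % 2 = 0 ∧ c ≤ z.1 ∧ z.1 < c + 6 ∧ c ≤ z.2 ∧ z.2 < W ∧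
      (z.1 = c + 2 ∨ z.2 < c + 6) ∧ (c = 0 → ¬ (z.1 = 0 ∧ z.2 = 0))) ∨
    (z.1 = c + 5 ∧ z.2 % 2 = 0 ∧ c ≤ z.2 ∧ z.2 < c + 6) ∨
    (z.2 = c + 5 ∧ (z.1 = c ∨ z.1 = c + 4)) ∨
    (z.2 = W ∧ (z.1 = c + 3 ∨ z.1 = c + 5)) ∨ leftover c z

/-- The band after the jumps in its bottom left corner. -/
def cornerDone (W c : ℤ) (z : ℤ × ℤ) : Prop :=
  (z.1 = c + 2 ∧ ((z.2 % 2 = 0 ∧ c + 6 ≤ z.2 ∧ z.2 < W) ∨ z.2 = c + 5)) ∨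
    (z.2 = W ∧ (z.1 = c + 3 ∨ z.1 = c + 5)) ∨ (z.1 = c + 5 ∧ z.2 = c + 4)

/-- The band after its last column has been swept up. -/
def upDone (W c : ℤ) (z : ℤ × ℤ) : Prop :=
  (z.2 = W ∧ (z.1 = c + 2 ∨ z.1 = c + 3 ∨ z.1 = c + 5)) ∨ (z.1 = c + 5 ∧ z.2 = c + 4)

/-- The reduced band. -/
def bandDone (W c : ℤ) (z : ℤ × ℤ) : Prop :=
  (z.2 = W ∧ z.1 = c + 6) ∨ (z.1 = c + 5 ∧ z.2 = c + 4)

theorem reaches_row {n : ℕ} {W c r : ℤ} (hn : (n : ℤ) = W + 1) (hc : 0 ≤ c) (hc2 : c % 2 = 0)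
    (hW2 : W % 2 = 1) (hcW : c + 11 ≤ W) (hr : 0 ≤ r) (hr2 : r ≤ 2) :
    Reaches (Rhombus n) (fun z => core W c z ∨ rowsSwept W c r z)
      (fun z => core W c z ∨ rowsSwept W c (r + 1) z) := by
  refine reaches_left (a := c + 5) (b := W) (y := c + 2 * r) (by omega) (by omega) (by omega)
    (by omega) (by omega) (by omega) ?_ ?_ ?_
  · intro x h1 h2
    simp only [core, rowsSwept, leftover]
    grind (splits := 40)
  · intro x h1 h2
    simp only [core, rowsSwept, leftover]
    grind (splits := 40)
  · intro x y h
    refine or_congr_right ?_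
    simp only [rowsSwept, leftover]
    grind (splits := 40)

theorem reaches_top {n : ℕ} {W c : ℤ} (hn : (n : ℤ) = W + 1) (hc : 0 ≤ c) (hc2 : c % 2 = 0)
    (hW2 : W % 2 = 1) (hcW : c + 11 ≤ W) :
    Reaches (Rhombus n) (fun z => core W c z ∨ rowsSwept W c 3 z)
      (fun z => core W c z ∨ topDone W c z) := by
  refine BoxRun.reaches (lo := (0, 0)) (hi := (6, 2)) (o := (c, W - 2))
    (T := {(6, 1), (0, 1), (0, 2), (2, 1), (3, 2), (4, 0), (5, 2)}) ?_
    [((4, 2), (0, -1)), ((6, 2), (-1, 0)), ((3, 2), (1, 0)), ((1, 2), (1, 0))] _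
    {(6, 1), (0, 1), (2, 1), (4, 1), (0, 2), (1, 2), (2, 2), (3, 2), (4, 2), (5, 2), (6, 2)}
    (by decide) (by decide) ?_ ?_ ?_
  · intro x y h1 h2 h3 h4
    simp only [Prod.mk_add_mk, mem_Rhombus] at *; omega
  · intro x y h1 h2 h3 h4
    simp only [Prod.mk_add_mk, core, rowsSwept, leftover, Finset.mem_insert,
      Finset.mem_singleton, Prod.mk.injEq] at *
    interval_cases x <;> interval_cases y <;> grind
  · intro x y h1 h2 h3 h4
    simp only [Prod.mk_add_mk, core, topDone, leftover, Finset.mem_insert,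
      Finset.mem_singleton, Prod.mk.injEq] at *
    interval_cases x <;> interval_cases y <;> grind
  · intro x y h
    refine or_congr_right ?_
    simp only [Prod.mk_add_mk, rowsSwept, topDone, leftover] at *
    grind (splits := 40)

theorem reaches_leftColumn {n : ℕ} {W c : ℤ} (hn : (n : ℤ) = W + 1) (hc : 0 ≤ c)
    (hc2 : c % 2 = 0) (hW2 : W % 2 = 1) (hcW : c + 11 ≤ W) :
    Reaches (Rhombus n) (fun z => core W c z ∨ topDone W c z)
      (fun z => core W c z ∨ leftDone W c z) := by
  refine reaches_down (a := c + 5) (b := W) (x := c) (by omega) (by omega) (by omega)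
    (by omega) (by omega) (by omega) ?_ ?_ ?_
  · intro y h1 h2
    simp only [core, topDone, leftover]
    grind (splits := 40)
  · intro y h1 h2
    simp only [core, leftDone, leftover]
    grind (splits := 40)
  · intro x y h
    refine or_congr_right ?_
    simp only [topDone, leftDone, leftover]
    grind (splits := 40)

theorem reaches_columns {n : ℕ} {W c : ℤ} (hn : (n : ℤ) = W + 1) (hc : 0 ≤ c)
    (hc2 : c % 2 = 0) (hW2 : W % 2 = 1) (hcW : c + 11 ≤ W) :
    Reaches (Rhombus n) (fun z => core W c z ∨ leftDone W c z)
      (fun z => core W c z ∨ columnsDone W c z) := by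
  refine reaches_down (a := c + 5) (b := W - 2) (x := c + 4) (by omega) (by omega) (by omega)
    (by omega) (by omega) (by omega) ?_ ?_ ?_
  · intro y h1 h2
    simp only [core, leftDone, leftover]
    grind (splits := 40)
  · intro y h1 h2
    simp only [core, columnsDone, leftover]
    grind (splits := 40)
  · intro x y h
    refine or_congr_right ?_
    simp only [leftDone, columnsDone, leftover]
    grind (splits := 40)

theorem reaches_up_column {n : ℕ} {W c : ℤ} (hn : (n : ℤ) = W + 1) (hc : 0 ≤ c)
    (hc2 : c % 2 = 0) (hW2 : W % 2 = 1) (hcW : c + 11 ≤ W) :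
    Reaches (Rhombus n) (fun z => core W c z ∨ cornerDone W c z)
      (fun z => core W c z ∨ upDone W c z) := by
  refine reaches_up (a := c + 5) (b := W) (x := c + 2) (by omega) (by omega) (by omega)
    (by omega) (by omega) (by omega) ?_ ?_ ?_
  · intro y h1 h2
    simp only [core, cornerDone]
    grind (splits := 40)
  · intro y h1 h2
    simp only [core, upDone]
    grind (splits := 40)
  · intro x y h
    refine or_congr_right ?_
    simp only [cornerDone, upDone]
    grind (splits := 40)

theorem reaches_band {n : ℕ} {W c : ℤ} (hn : (n : ℤ) = W + 1) (hc : 0 ≤ c)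
    (hc2 : c % 2 = 0) (hW2 : W % 2 = 1) (hcW : c + 11 ≤ W) :
    Reaches (Rhombus n) (fun z => core W c z ∨ upDone W c z)
      (fun z => core W c z ∨ bandDone W c z) := by
  refine BoxRun.reaches (lo := (2, 0)) (hi := (6, 0)) (o := (c, W)) (T := {(6, 0)}) ?_
    [((2, 0), (1, 0)), ((4, 0), (1, 0))] _ {(2, 0), (3, 0), (5, 0)}
    (by decide) (by decide) ?_ ?_ ?_
  · intro x y h1 h2 h3 h4
    simp only [Prod.mk_add_mk, mem_Rhombus] at *; omega
  · intro x y h1 h2 h3 h4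
    simp only [Prod.mk_add_mk, core, upDone, Finset.mem_insert,
      Finset.mem_singleton, Prod.mk.injEq] at *
    grind (splits := 40)
  · intro x y h1 h2 h3 h4
    simp only [Prod.mk_add_mk, core, bandDone,
      Finset.mem_singleton, Prod.mk.injEq] at *
    grind (splits := 40)
  · intro x y h
    refine or_congr_right ?_
    simp only [Prod.mk_add_mk, upDone, bandDone] at *
    grind (splits := 40)

theorem reaches_corner_zero {n : ℕ} {W c : ℤ} (hn : (n : ℤ) = W + 1) (hc : c = 0)
    (hW2 : W % 2 = 1) (hcW : c + 11 ≤ W) :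
    Reaches (Rhombus n) (fun z => core W c z ∨ columnsDone W c z)
      (fun z => core W c z ∨ cornerDone W c z) := by
  refine BoxRun.reaches (lo := (0, 0)) (hi := (5, 5)) (o := (c, c)) (T := {(2, 5), (5, 4)}) ?_
    [((0, 5), (0, -1)), ((0, 3), (0, -1)), ((5, 0), (-1, 0)), ((4, 5), (0, -1)),
    ((4, 3), (0, -1)), ((2, 0), (1, 0)), ((4, 0), (0, 1)), ((5, 2), (-1, 0)),
    ((3, 2), (-1, 0)), ((0, 1), (1, 1)), ((2, 3), (0, 1))] _
    {(0, 2), (0, 4), (2, 0), (2, 2), (2, 4), (4, 0), (4, 2), (4, 4), (5, 0), (5, 2), (5, 4), (0, 5),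
      (4, 5)}
    (by decide) (by decide) ?_ ?_ ?_
  · intro x y h1 h2 h3 h4
    simp only [Prod.mk_add_mk, mem_Rhombus] at *; omega
  · intro x y h1 h2 h3 h4
    simp only [Prod.mk_add_mk, core, columnsDone, leftover, Finset.mem_insert,
      Finset.mem_singleton, Prod.mk.injEq] at *
    interval_cases x <;> interval_cases y <;> grind
  · intro x y h1 h2 h3 h4
    simp only [Prod.mk_add_mk, core, cornerDone, Finset.mem_insert,
      Finset.mem_singleton, Prod.mk.injEq] at *
    interval_cases x <;> interval_cases y <;> grind
  · intro x y h
    refine or_congr_right ?_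
    simp only [Prod.mk_add_mk, columnsDone, cornerDone, leftover] at *
    grind (splits := 40)

theorem reaches_corner_pos {n : ℕ} {W c : ℤ} (hn : (n : ℤ) = W + 1) (hc : 0 < c)
    (hc2 : c % 2 = 0) (hW2 : W % 2 = 1) (hcW : c + 11 ≤ W) :
    Reaches (Rhombus n) (fun z => core W c z ∨ columnsDone W c z)
      (fun z => core W c z ∨ cornerDone W c z) := by
  refine BoxRun.reaches (lo := (-1, -2)) (hi := (5, 5)) (o := (c, c)) (T := {(2, 5), (5, 4)}) ?_
    [((0, 5), (0, -1)), ((5, 0), (-1, 0)), ((0, 3), (0, -1)), ((0, 1), (0, -1)),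
    ((4, 5), (0, -1)), ((-1, -2), (1, 1)), ((5, 2), (-1, 0)), ((4, 3), (-1, -1)),
    ((2, 1), (-1, -1)), ((3, 0), (-1, 0)), ((0, -1), (1, 1)), ((2, 1), (0, 1)),
    ((2, 3), (0, 1))] _
    {(-1, -2), (0, 0), (0, 2), (0, 4), (2, 0), (2, 2), (2, 4), (4, 0), (4, 2), (4, 4),
      (5, 0), (5, 2), (5, 4), (0, 5),
      (4, 5)}
    (by decide) (by decide) ?_ ?_ ?_
  · intro x y h1 h2 h3 h4
    simp only [Prod.mk_add_mk, mem_Rhombus] at *; omega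
  · intro x y h1 h2 h3 h4
    simp only [Prod.mk_add_mk, core, columnsDone, leftover, Finset.mem_insert,
      Finset.mem_singleton, Prod.mk.injEq] at *
    interval_cases x <;> interval_cases y <;> grind
  · intro x y h1 h2 h3 h4
    simp only [Prod.mk_add_mk, core, cornerDone, Finset.mem_insert,
      Finset.mem_singleton, Prod.mk.injEq] at *
    interval_cases x <;> interval_cases y <;> grind
  · intro x y h
    refine or_congr_right ?_
    simp only [Prod.mk_add_mk, columnsDone, cornerDone, leftover] at *
    grind (splits := 40)

theorem reaches_last_zero {n : ℕ} {W c : ℤ} (hn : (n : ℤ) = W + 1) (hc : c = 0)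
    (hcW : W = c + 5) :
    Reaches (Rhombus n) (fun z => stage W c z)
      (fun z => z.1 = W ∧ (z.2 = c ∨ (z.2 % 2 = 1 ∧ 0 ≤ z.2 ∧ z.2 < c))) := by
  refine BoxRun.reaches (lo := (0, 0)) (hi := (5, 5)) (o := (c, c)) (T := {(5, 0)}) ?_
    [((5, 0), (-1, 0)), ((0, 5), (0, -1)), ((5, 5), (-1, -1)), ((5, 3), (-1, -1)),
    ((5, 1), (0, 1)), ((5, 4), (0, -1)), ((0, 2), (0, 1)), ((2, 5), (-1, 0)),
    ((0, 5), (0, -1)), ((4, 5), (-1, 0)), ((2, 5), (0, -1)), ((3, 3), (-1, 0)),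
    ((0, 3), (1, 0)), ((2, 3), (0, -1)), ((2, 1), (1, 0)), ((2, 0), (1, 0)),
    ((5, 2), (-1, -1)), ((3, 0), (1, 0))] _
    {(0, 2), (0, 4), (2, 0), (2, 2), (2, 4), (4, 0), (4, 2), (4, 4),
      (5, 0), (5, 1), (5, 2), (5, 3), (5, 4), (5, 5), (0, 5), (1, 5), (2, 5),
      (3, 5), (4, 5)}
    (by decide) (by decide) ?_ ?_ ?_
  · intro x y h1 h2 h3 h4
    simp only [Prod.mk_add_mk, mem_Rhombus] at *; omega
  · intro x y h1 h2 h3 h4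
    simp only [Prod.mk_add_mk, stage, leftover, Finset.mem_insert,
      Finset.mem_singleton, Prod.mk.injEq] at *
    interval_cases x <;> interval_cases y <;> grind
  · intro x y h1 h2 h3 h4
    simp only [Prod.mk_add_mk, Finset.mem_singleton, Prod.mk.injEq] at *
    interval_cases x <;> interval_cases y <;> grind
  · intro x y h
    simp only [Prod.mk_add_mk, stage, leftover] at *
    grind (splits := 40)

theorem reaches_last_pos {n : ℕ} {W c : ℤ} (hn : (n : ℤ) = W + 1) (hc : 0 < c)
    (hc2 : c % 2 = 0) (hcW : W = c + 5) :
    Reaches (Rhombus n) (fun z => stage W c z)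
      (fun z => z.1 = W ∧ (z.2 = c ∨ (z.2 % 2 = 1 ∧ 0 ≤ z.2 ∧ z.2 < c))) := by
  refine BoxRun.reaches (lo := (-1, -2)) (hi := (5, 5)) (o := (c, c)) (T := {(5, 0), (5, -1)}) ?_
    [((5, 3), (-1, -1)), ((5, 5), (0, -1)), ((2, 0), (1, 1)), ((5, 0), (-1, 0)),
    ((0, 5), (0, -1)), ((2, 5), (0, -1)), ((4, 5), (-1, 0)), ((2, 3), (0, -1)),
    ((1, 5), (1, 0)), ((0, 3), (0, -1)), ((0, 1), (0, -1)), ((-1, -2), (1, 1)),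
    ((1, 0), (1, 1)), ((5, 2), (0, 1)), ((5, 4), (-1, 0)), ((3, 5), (0, -1)),
    ((3, 3), (0, -1)), ((3, 0), (0, 1)), ((3, 2), (1, 0)), ((5, 2), (0, -1))] _
    {(-1, -2), (5, -1), (0, 0), (0, 2), (0, 4), (2, 0), (2, 2), (2, 4), (4, 0), (4, 2), (4, 4),
      (5, 0), (5, 1), (5, 2), (5, 3), (5, 4), (5, 5), (0, 5), (1, 5), (2, 5),
      (3, 5), (4, 5)}
    (by decide) (by decide) ?_ ?_ ?_
  · intro x y h1 h2 h3 h4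
    simp only [Prod.mk_add_mk, mem_Rhombus] at *; omega
  · intro x y h1 h2 h3 h4
    simp only [Prod.mk_add_mk, stage, leftover, Finset.mem_insert,
      Finset.mem_singleton, Prod.mk.injEq] at *
    interval_cases x <;> interval_cases y <;> grind
  · intro x y h1 h2 h3 h4
    simp only [Prod.mk_add_mk, Finset.mem_insert,
      Finset.mem_singleton, Prod.mk.injEq] at *
    interval_cases x <;> interval_cases y <;> grind
  · intro x y h
    simp only [Prod.mk_add_mk, stage, leftover] at *
    grind (splits := 40)

theorem reaches_stage_succ {n : ℕ} {W c : ℤ} (hn : (n : ℤ) = W + 1) (hc : 0 ≤ c)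
    (hc2 : c % 2 = 0) (hW2 : W % 2 = 1) (hcW : c + 11 ≤ W) :
    Reaches (Rhombus n) (stage W c) (stage W (c + 6)) := by
  have hrows := fun r => reaches_row (n := n) (r := r) hn hc hc2 hW2 hcW
  have hcorner : Reaches (Rhombus n) (fun z => core W c z ∨ columnsDone W c z)
      (fun z => core W c z ∨ cornerDone W c z) := by
    rcases hc.eq_or_lt with h | h
    · exact reaches_corner_zero hn h.symm hW2 hcW
    · exact reaches_corner_pos hn h hc2 hW2 hcW
  refine Reaches.trans (Reaches.of_iff (g := fun z => core W c z ∨ rowsSwept W c 0 z) ?_) <|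
    (hrows 0 (by omega) (by omega)).trans <| (hrows 1 (by omega) (by omega)).trans <|
    (hrows 2 (by omega) (by omega)).trans <| (reaches_top hn hc hc2 hW2 hcW).trans <|
    (reaches_leftColumn hn hc hc2 hW2 hcW).trans <| (reaches_columns hn hc hc2 hW2 hcW).trans <|
    hcorner.trans <| (reaches_up_column hn hc hc2 hW2 hcW).trans <|
    (reaches_band hn hc hc2 hW2 hcW).trans <| Reaches.of_iff ?_
  · rintro ⟨x, y⟩
    simp only [stage, core, rowsSwept, leftover]
    grind (splits := 40)
  · rintro ⟨x, y⟩
    simp only [stage, core, bandDone, leftover]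
    grind (splits := 40)

theorem reaches_last {n : ℕ} {W c : ℤ} (hn : (n : ℤ) = W + 1) (hc : 0 ≤ c) (hc2 : c % 2 = 0)
    (hcW : W = c + 5) : Reaches (Rhombus n) (stage W c) (fun z => z.1 = W ∧ z.2 = 0) := by
  have h : Reaches (Rhombus n) (stage W c)
      (fun z => z.1 = W ∧ (z.2 = c ∨ (z.2 % 2 = 1 ∧ 0 ≤ z.2 ∧ z.2 < c))) := by
    rcases hc.eq_or_lt with h | h
    · exact reaches_last_zero hn h.symm hcW
    · exact reaches_last_pos hn h hc2 hcW
  refine h.trans (reaches_down (a := 0) (b := c) (x := W) (by omega) (by omega) (by omega)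
    (by omega) (by omega) (by omega) ?_ ?_ ?_)
  · intro y h1 h2; dsimp only; omega
  · intro y h1 h2; dsimp only; omega
  · intro x y h; dsimp only; omega

theorem reaches_stage {n : ℕ} {W : ℤ} (hn : (n : ℤ) = W + 1) (hW2 : W % 2 = 1) (k : ℕ) :
    ∀ c : ℤ, 0 ≤ c → c % 2 = 0 → W = c + 6 * k + 5 →
      Reaches (Rhombus n) (stage W c) (fun z => z.1 = W ∧ z.2 = 0) := by
  induction k with
  | zero => exact fun c hc hc2 hcW => reaches_last hn hc hc2 (by simpa using hcW)
  | succ k ih =>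
    intro c hc hc2 hcW
    push_cast at hcW
    exact (reaches_stage_succ hn hc hc2 hW2 (by omega)).trans
      (ih (c + 6) (by omega) (by omega) (by omega))

theorem jumpStep_sdiff {B P Q : Finset (ℤ × ℤ)} (hP : P ⊆ B) (h : JumpStep B P Q) :
    Q ⊆ B ∧ JumpStep B (B \ Q) (B \ P) := by
  obtain ⟨p, d, ⟨hd, hp, hpd, hB, hpdd⟩, rfl⟩ := h
  have h1 : p ≠ p + d + d := fun e => hpdd (e ▸ hp)
  have h2 : p + d ≠ p + d + d := fun e => hpdd (e ▸ hpd)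
  refine ⟨fun z hz => ?_, p, d, ⟨hd, ?_, ?_, hB, ?_⟩, ?_⟩
  · rcases mem_jumpResult.1 hz with hz | rfl
    · exact hP hz.1
    · exact hB
  · simp [mem_jumpResult, hP hp, h1]
  · simp only [Finset.mem_sdiff, mem_jumpResult, hP hpd, h2]; simp
  · simp [mem_jumpResult]
  · ext z
    simp only [mem_jumpResult, Finset.mem_sdiff]
    by_cases e : z = p
    · subst e; simp [hp, h1]
    by_cases e' : z = p + d
    · subst e'; simp [hpd, h2]
    by_cases e'' : z = p + d + d
    · subst e''; simp [hB, hpdd]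
    simp [e, e', e'']

theorem reflTransGen_sdiff {B P Q : Finset (ℤ × ℤ)} (hP : P ⊆ B)
    (h : Relation.ReflTransGen (JumpStep B) P Q) :
    Q ⊆ B ∧ Relation.ReflTransGen (JumpStep B) (B \ Q) (B \ P) := by
  induction h with
  | refl => exact ⟨hP, .refl⟩
  | tail _ hstep ih =>
    obtain ⟨h1, h2⟩ := jumpStep_sdiff ih.1 hstep
    exact ⟨h1, .head h2 ih.2⟩

theorem exists_plays_append {B P Q R : Finset (ℤ × ℤ)}
    {ns : List ((ℤ × ℤ) × List (ℤ × ℤ))} (h : Relation.ReflTransGen (JumpStep B) P Q)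
    (hns : Plays B Q ns R) : ∃ ms, Plays B P (ms ++ ns) R := by
  induction h using Relation.ReflTransGen.head_induction_on with
  | refl => exact ⟨[], hns⟩
  | head hstep _ ih =>
    obtain ⟨p, d, hok, rfl⟩ := hstep
    obtain ⟨ms, hms⟩ := ih
    exact ⟨(p, [d]) :: ms, .cons ⟨List.cons_ne_nil _ _, _, .cons hok (.nil _ _)⟩ hms⟩

/-- The holes jumped over by a sweep starting at `s` with directions `ds`. -/
def sweepMids (s : ℤ × ℤ) : List (ℤ × ℤ) → List (ℤ × ℤ)
  | [] => []
  | d :: ds => (s + d) :: sweepMids (s + d + d) ds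

theorem dirs_parity {d : ℤ × ℤ} (hd : d ∈ Dirs) : ¬ (d.1 % 2 = 0 ∧ d.2 % 2 = 0) := by
  revert d; decide

theorem not_even_of_mem_sweepMids (ds : List (ℤ × ℤ)) :
    ∀ s : ℤ × ℤ, (∀ d ∈ ds, d ∈ Dirs) → s.1 % 2 = 0 ∧ s.2 % 2 = 0 →
      ∀ z ∈ sweepMids s ds, ¬ (z.1 % 2 = 0 ∧ z.2 % 2 = 0) := by
  induction ds with
  | nil => simp [sweepMids]
  | cons d ds ih =>
    intro s hds hs z hz
    rcases List.mem_cons.1 hz with rfl | hz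
    · have := dirs_parity (hds d (by simp))
      simp only [Prod.fst_add, Prod.snd_add]; omega
    · refine ih (s + d + d) (fun d' h => hds d' (by simp [h])) ?_ z hz
      simp only [Prod.fst_add, Prod.snd_add]; omega

/-- A sweep through holes with even coordinates is legal when it captures each peg only once and
no other peg sits in a hole with even coordinates. -/
theorem exists_sweepFrom {B : Finset (ℤ × ℤ)} (ds : List (ℤ × ℤ)) :
    ∀ (s : ℤ × ℤ) (P : Finset (ℤ × ℤ)), (∀ d ∈ ds, d ∈ Dirs) → s.1 % 2 = 0 ∧ s.2 % 2 = 0 →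
      s ∈ P → (∀ z ∈ P, z.1 % 2 = 0 ∧ z.2 % 2 = 0 → z = s) → (sweepMids s ds).Nodup →
      (∀ z ∈ sweepMids s ds, z ∈ P) → (∀ z ∈ sweepHoles s ds, z ∈ B) →
      ∃ Q, SweepFrom B P s ds (sweepEnd s ds) Q ∧
        ∀ z, z ∈ Q ↔ z = sweepEnd s ds ∨ (z ∈ P ∧ z ≠ s ∧ z ∉ sweepMids s ds) := by
  induction ds with
  | nil =>
    intro s P _ _ hsP _ _ _ _
    refine ⟨P, .nil P s, fun z => ?_⟩
    by_cases h : z = s <;> simp [sweepEnd, sweepMids, h, hsP]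
  | cons d ds ih =>
    intro s P hds hs hsP huniq hnodup hmids hB
    have hd : d ∈ Dirs := hds d (by simp)
    have hds' : ∀ d' ∈ ds, d' ∈ Dirs := fun d' h => hds d' (by simp [h])
    have hs' : (s + d + d).1 % 2 = 0 ∧ (s + d + d).2 % 2 = 0 := by
      simp only [Prod.fst_add, Prod.snd_add]; omega
    have hne : s + d + d ≠ s := by
      intro h
      have h1 := congrArg Prod.fst h
      have h2 := congrArg Prod.snd h
      simp only [Prod.fst_add, Prod.snd_add] at h1 h2
      exact dirs_parity hd (by omega)
    have hland : s + d + d ∉ P := fun h => hne (huniq _ h hs')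
    have hmem : s + d + d ∈ B := hB _ <| by
      cases ds <;> simp [sweepHoles]
    obtain ⟨hnot, hnodup'⟩ := List.nodup_cons.1 hnodup
    have hok : JumpOK B P s d := ⟨hd, hsP, hmids _ (by simp [sweepMids]), hmem, hland⟩
    obtain ⟨Q, hQ, hQz⟩ := ih (s + d + d) (jumpResult P s d) hds' hs'
      (mem_jumpResult.2 (.inr rfl))
      (fun z hz hz2 => by
        rcases mem_jumpResult.1 hz with hz | hz
        · exact absurd (huniq z hz.1 hz2) hz.2.1
        · exact hz)
      hnodup'
      (fun z hz => mem_jumpResult.2 <| .inl ⟨hmids z (by simp [sweepMids, hz]),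
        fun h => not_even_of_mem_sweepMids ds _ hds' hs' z hz (h ▸ hs),
        fun h => hnot (h ▸ hz)⟩)
      (fun z hz => hB z (by simp [sweepHoles, hz]))
    refine ⟨Q, .cons hok hQ, fun z => ?_⟩
    rw [hQz, mem_jumpResult]
    simp only [sweepEnd, sweepMids, List.mem_cons, not_or]
    by_cases h : z = s + d + d
    · subst h; simp [hland]
    · simp only [h, or_false, ne_eq, not_false_eq_true, true_and]; tauto

/-- A sweep from `s` to `e` through holes of `{0, …, N} × {0, …, N}` that jumps exactly once over
each hole of `M` and over no other hole. -/
structure IsTrail (N : ℤ) (s : ℤ × ℤ) (ds : List (ℤ × ℤ)) (e : ℤ × ℤ) (M : ℤ × ℤ → Prop) :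
    Prop where
  dirs : ∀ d ∈ ds, d ∈ Dirs
  sweepEnd_eq : sweepEnd s ds = e
  mem_mids : ∀ z, z ∈ sweepMids s ds ↔ M z
  nodup : (sweepMids s ds).Nodup
  holes : ∀ z ∈ sweepHoles s ds, (0 ≤ z.1 ∧ z.1 ≤ N) ∧ 0 ≤ z.2 ∧ z.2 ≤ N

namespace IsTrail

variable {N : ℤ} {s e e' : ℤ × ℤ} {ds ds' : List (ℤ × ℤ)} {M M' : ℤ × ℤ → Prop}

theorem of_iff (h : IsTrail N s ds e M) (hM : ∀ x y, M (x, y) ↔ M' (x, y)) :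
    IsTrail N s ds e M' :=
  { h with mem_mids := fun z => (h.mem_mids z).trans (hM z.1 z.2) }

theorem nil (hs : (0 ≤ s.1 ∧ s.1 ≤ N) ∧ 0 ≤ s.2 ∧ s.2 ≤ N) :
    IsTrail N s [] s (fun _ => False) where
  dirs := by simp
  sweepEnd_eq := rfl
  mem_mids := by simp [sweepMids]
  nodup := by simp [sweepMids]
  holes := by simpa [sweepHoles] using hs

theorem cons {d : ℤ × ℤ} (hd : d ∈ Dirs) (hs : (0 ≤ s.1 ∧ s.1 ≤ N) ∧ 0 ≤ s.2 ∧ s.2 ≤ N)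
    (hsd : (0 ≤ (s + d).1 ∧ (s + d).1 ≤ N) ∧ 0 ≤ (s + d).2 ∧ (s + d).2 ≤ N)
    (h : IsTrail N (s + d + d) ds e M) (hM : ¬ M (s + d)) :
    IsTrail N s (d :: ds) e (fun z => z = s + d ∨ M z) where
  dirs := by simpa [hd] using h.dirs
  sweepEnd_eq := h.sweepEnd_eq
  mem_mids z := by simp [sweepMids, h.mem_mids]
  nodup := by
    rw [sweepMids, List.nodup_cons, h.mem_mids]
    exact ⟨hM, h.nodup⟩
  holes z hz := by
    simp only [sweepHoles, List.mem_cons] at hz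
    rcases hz with rfl | rfl | hz
    exacts [hs, hsd, h.holes z hz]

theorem append (h : IsTrail N s ds e M) (h' : IsTrail N e ds' e' M')
    (hM : ∀ x y, M (x, y) → ¬ M' (x, y)) :
    IsTrail N s (ds ++ ds') e' (fun z => M z ∨ M' z) := by
  induction ds generalizing s M with
  | nil =>
    obtain rfl : s = e := h.sweepEnd_eq
    exact h'.of_iff fun x y => by simp [← h.mem_mids, sweepMids]
  | cons d ds ih =>
    have hn := List.nodup_cons.1 h.nodup
    have ht : IsTrail N (s + d + d) ds e (fun z => z ∈ sweepMids (s + d + d) ds) :=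
      ⟨fun d' hd' => h.dirs d' (by simp [hd']), h.sweepEnd_eq, fun _ => .rfl, hn.2,
        fun z hz => h.holes z (by simp [sweepHoles, hz])⟩
    have hsub : ∀ z, M z ↔ z = s + d ∨ z ∈ sweepMids (s + d + d) ds := fun z => by
      rw [← h.mem_mids]; simp [sweepMids]
    refine (IsTrail.cons (h.dirs d (by simp)) (h.holes s (by simp [sweepHoles]))
      (h.holes (s + d) (by simp [sweepHoles]))
      (ih ht fun x y hxy => hM x y ((hsub _).2 (.inr hxy))) ?_).of_iff ?_
    · rintro (hc | hc)
      · exact hn.1 hc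
      · exact hM (s + d).1 (s + d).2 ((hsub _).2 (.inl rfl)) hc
    · intro x y; rw [hsub, or_assoc]

end IsTrail

/-- The zigzag to the left along a row. -/
def zigLeft : ℕ → List (ℤ × ℤ)
  | 0 => [(0, 1)]
  | m + 1 => (0, 1) :: (-1, -1) :: zigLeft m

/-- The zigzag up along a column. -/
def zigUp : ℕ → List (ℤ × ℤ)
  | 0 => []
  | m + 1 => (-1, 0) :: (1, 1) :: zigUp m

/-- The directions of a sweep from `(0, 0)` to `(2 * m, 2 * m)` that jumps over every hole of
`{0, …, 2 * m} × {0, …, 2 * m}` with an odd coordinate. -/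
def trail : ℕ → List (ℤ × ℤ)
  | 0 => []
  | m + 1 => trail m ++ (zigLeft m ++ (List.replicate (m + 1) (1, 0) ++
      (List.replicate (m + 1) (0, -1) ++ zigUp (m + 1))))

theorem length_zigLeft (m : ℕ) : (zigLeft m).length = 2 * m + 1 := by
  induction m with
  | zero => rfl
  | succ m ih => simp [zigLeft, ih]; ring

theorem length_zigUp (m : ℕ) : (zigUp m).length = 2 * m := by
  induction m with
  | zero => rfl
  | succ m ih => simp [zigUp, ih]; ring

theorem length_trail (m : ℕ) : (trail m).length = (3 * m + 2) * m := by
  induction m with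
  | zero => rfl
  | succ m ih => simp [trail, ih, length_zigLeft, length_zigUp]; ring

theorem isTrail_zigLeft {N Y : ℤ} (m : ℕ) (hm : 2 * (m : ℤ) ≤ N) (hY : 0 ≤ Y) (hY' : Y + 2 ≤ N) :
    IsTrail N (2 * m, Y) (zigLeft m) (0, Y + 2)
      (fun z => 0 ≤ z.1 ∧ z.1 ≤ 2 * m ∧ z.2 = Y + 1) := by
  induction m with
  | zero =>
    have h := IsTrail.cons (N := N) (s := (0, Y)) (d := (0, 1)) (by decide) (by dsimp; omega)
      (by simp; omega) (IsTrail.nil (by simp; omega)) (by simp)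
    simp only [Prod.mk_add_mk, add_zero, add_assoc, one_add_one_eq_two] at h
    refine h.of_iff fun x y => ?_
    simp only [Prod.mk.injEq, or_false]; push_cast; omega
  | succ m ih =>
    push_cast at hm
    have e : ((2 * ((m + 1 : ℕ) : ℤ), Y) + (0, 1) + (0, 1) + (-1, -1) + (-1, -1) : ℤ × ℤ)
        = (2 * (m : ℤ), Y) := by
      simp only [Prod.mk_add_mk, Prod.mk.injEq]; push_cast; omega
    refine (IsTrail.cons (by decide) (by push_cast; omega)
      (by simp only [Prod.mk_add_mk]; push_cast; omega)
      (IsTrail.cons (by decide) (by simp only [Prod.mk_add_mk]; push_cast; omega)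
        (by simp only [Prod.mk_add_mk]; push_cast; omega) (e ▸ ih (by omega)) ?_) ?_).of_iff ?_
    · simp only [Prod.mk_add_mk]; push_cast; omega
    · simp only [Prod.mk_add_mk, Prod.mk.injEq]; push_cast; omega
    · intro x y; simp only [Prod.mk_add_mk, Prod.mk.injEq]; push_cast; omega

theorem isTrail_zigUp {N X : ℤ} (hX : 2 ≤ X) (hX' : X ≤ N) (m : ℕ) :
    ∀ Y : ℤ, 0 ≤ Y → Y + 2 * m ≤ N → IsTrail N (X, Y) (zigUp m) (X, Y + 2 * m)
      (fun z => z.1 = X - 1 ∧ Y ≤ z.2 ∧ z.2 < Y + 2 * m) := by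
  induction m with
  | zero =>
    intro Y hY hm
    have h := IsTrail.nil (N := N) (s := (X, Y)) (by dsimp; push_cast at hm; omega)
    simpa [zigUp] using h.of_iff (M' := fun z => z.1 = X - 1 ∧ Y ≤ z.2 ∧ z.2 < Y)
      fun x y => by simp only [false_iff]; omega
  | succ m ih =>
    intro Y hY hm
    push_cast at hm
    have e : ((X, Y) + (-1, 0) + (-1, 0) + (1, 1) + (1, 1) : ℤ × ℤ) = (X, Y + 2) := by
      simp only [Prod.mk_add_mk, Prod.mk.injEq]; omega
    have e' : ((X, Y + 2 * ((m + 1 : ℕ) : ℤ)) : ℤ × ℤ) = (X, Y + 2 + 2 * m) := by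
      simp only [Prod.mk.injEq, true_and]; push_cast; omega
    refine (IsTrail.cons (by decide) (by dsimp only; omega)
      (by simp only [Prod.mk_add_mk]; omega)
      (IsTrail.cons (by decide) (by simp only [Prod.mk_add_mk]; omega)
        (by simp only [Prod.mk_add_mk]; omega)
        (e ▸ e' ▸ ih (Y + 2) (by omega) (by omega)) ?_) ?_).of_iff ?_
    · simp only [Prod.mk_add_mk]; omega
    · simp only [Prod.mk_add_mk, Prod.mk.injEq]; omega
    · intro x y; simp only [Prod.mk_add_mk, Prod.mk.injEq]; push_cast; omega

theorem isTrail_right {N Y : ℤ} (hY : 0 ≤ Y) (hY' : Y ≤ N) (m : ℕ) :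
    ∀ X : ℤ, 0 ≤ X → X + 2 * m ≤ N →
      IsTrail N (X, Y) (List.replicate m (1, 0)) (X + 2 * m, Y)
        (fun z => X ≤ z.1 ∧ z.1 < X + 2 * m ∧ (z.1 - X) % 2 = 1 ∧ z.2 = Y) := by
  induction m with
  | zero =>
    intro X hX hm
    have h := IsTrail.nil (N := N) (s := (X, Y)) (by dsimp; push_cast at hm; omega)
    simpa using h.of_iff (M' := fun z => X ≤ z.1 ∧ z.1 < X ∧ (z.1 - X) % 2 = 1 ∧ z.2 = Y)
      fun x y => by simp only [false_iff]; omega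
  | succ m ih =>
    intro X hX hm
    push_cast at hm
    have e : ((X, Y) + (1, 0) + (1, 0) : ℤ × ℤ) = (X + 2, Y) := by
      simp only [Prod.mk_add_mk, Prod.mk.injEq]; omega
    have e' : ((X + 2 * ((m + 1 : ℕ) : ℤ), Y) : ℤ × ℤ) = (X + 2 + 2 * m, Y) := by
      simp only [Prod.mk.injEq, and_true]; push_cast; omega
    refine (IsTrail.cons (by decide) (by dsimp only; omega) (by simp only [Prod.mk_add_mk]; omega)
      (e ▸ e' ▸ ih (X + 2) (by omega) (by omega)) ?_).of_iff ?_
    · simp only [Prod.mk_add_mk]; omega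
    · intro x y; simp only [Prod.mk_add_mk, Prod.mk.injEq]; push_cast; omega

theorem isTrail_down {N X : ℤ} (hX : 0 ≤ X) (hX' : X ≤ N) (m : ℕ) (hm : 2 * (m : ℤ) ≤ N) :
    IsTrail N (X, 2 * m) (List.replicate m (0, -1)) (X, 0)
      (fun z => z.1 = X ∧ 0 ≤ z.2 ∧ z.2 < 2 * m ∧ z.2 % 2 = 1) := by
  induction m with
  | zero =>
    have h := IsTrail.nil (N := N) (s := (X, 0)) (by dsimp; push_cast at hm; omega)
    simpa using h.of_iff (M' := fun z => z.1 = X ∧ 0 ≤ z.2 ∧ z.2 < 0 ∧ z.2 % 2 = 1)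
      fun x y => by simp only [false_iff]; omega
  | succ m ih =>
    push_cast at hm
    have e : ((X, 2 * ((m + 1 : ℕ) : ℤ)) + (0, -1) + (0, -1) : ℤ × ℤ) = (X, 2 * (m : ℤ)) := by
      simp only [Prod.mk_add_mk, Prod.mk.injEq]; push_cast; omega
    refine (IsTrail.cons (by decide) (by push_cast; omega)
      (by simp only [Prod.mk_add_mk]; push_cast; omega) (e ▸ ih (by omega)) ?_).of_iff ?_
    · simp only [Prod.mk_add_mk]; push_cast; omega
    · intro x y; simp only [Prod.mk_add_mk, Prod.mk.injEq]; push_cast; omega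

theorem isTrail_trail {N : ℤ} (m : ℕ) (hm : 2 * (m : ℤ) ≤ N) :
    IsTrail N (0, 0) (trail m) (2 * m, 2 * m) (fun z => (0 ≤ z.1 ∧ z.1 ≤ 2 * m) ∧
      (0 ≤ z.2 ∧ z.2 ≤ 2 * m) ∧ ¬ (z.1 % 2 = 0 ∧ z.2 % 2 = 0)) := by
  induction m with
  | zero =>
    refine (IsTrail.nil (s := (0, 0)) (by simpa using hm)).of_iff fun x y => ?_
    simp only [false_iff]; push_cast; omega
  | succ m ih =>
    push_cast at hm
    have h1 := isTrail_zigLeft (N := N) (Y := 2 * m) m (by omega) (by omega) (by omega)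
    have h2 := isTrail_right (N := N) (Y := 2 * m + 2) (by omega) (by omega) (m + 1) 0 le_rfl
      (by push_cast; omega)
    have h3 := isTrail_down (N := N) (X := 2 * m + 2) (by omega) (by omega) (m + 1)
      (by push_cast; omega)
    have h4 := isTrail_zigUp (N := N) (X := 2 * m + 2) (by omega) (by omega) (m + 1) 0 le_rfl
      (by push_cast; omega)
    have e : (2 * ((m + 1 : ℕ) : ℤ)) = 2 * m + 2 := by push_cast; ring
    rw [e] at h2 h3 h4 ⊢
    rw [zero_add] at h2 h4
    refine ((ih (by omega)).append (h1.append (h2.append (h3.append h4 ?_) ?_) ?_) ?_).of_iff ?_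
    all_goals
      intro x y; dsimp only; omega

/-- For every integer `i > 0`, there is a hole `v` on `Rhombus (6*i)` and a
solution to the single-vacancy problem with vacancy `v` whose last move is a sweep
of length `(9*i-1)*(3*i-1)`. -/
theorem rhombus6i_solution_with_final_maximal_sweep (i : ℕ) (hi : 0 < i) :
    ∃ v ∈ Rhombus (6 * i),
      ∃ (ms : List ((ℤ × ℤ) × List (ℤ × ℤ))) (m : (ℤ × ℤ) × List (ℤ × ℤ))
        (R : Finset (ℤ × ℤ)),
        Plays (Rhombus (6 * i)) ((Rhombus (6 * i)).erase v) (ms ++ [m]) R ∧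
        R.card = 1 ∧
        m.2.length = (9 * i - 1) * (3 * i - 1) := by
  classical
  set B := Rhombus (6 * i) with hB
  have hn : ((6 * i : ℕ) : ℤ) = (6 * i - 1 : ℤ) + 1 := by push_cast; ring
  have hmem : ∀ x y : ℤ, (x, y) ∈ B ↔ (0 ≤ x ∧ x ≤ 6 * i - 1) ∧ 0 ≤ y ∧ y ≤ 6 * i - 1 :=
    fun x y => by rw [hB, mem_Rhombus]; push_cast; rfl
  obtain ⟨Q, hQ, hCQ⟩ := reaches_stage hn (by omega) (i - 1) 0 le_rfl rfl (by omega)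
    (B.filter (stage (6 * i - 1) 0)) (by
      rintro ⟨x, y⟩
      simp only [Finset.mem_filter, hmem, and_iff_right_iff_imp, stage, leftover]
      omega)
  obtain rfl : Q = {((6 * i - 1 : ℤ), (0 : ℤ))} := by
    ext z; rw [hQ, Finset.mem_singleton, Prod.ext_iff]
  obtain ⟨hvB, hreach⟩ := reflTransGen_sdiff (Finset.filter_subset _ _) hCQ
  rw [Finset.sdiff_singleton_eq_erase] at hreach
  have hP : ∀ x y : ℤ, (x, y) ∈ B \ B.filter (stage (6 * i - 1) 0) ↔
      (x = 0 ∧ y = 0) ∨ ((0 ≤ x ∧ x ≤ 6 * i - 2) ∧ (0 ≤ y ∧ y ≤ 6 * i - 2) ∧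
        ¬ (x % 2 = 0 ∧ y % 2 = 0)) := by
    intro x y
    simp only [Finset.mem_sdiff, Finset.mem_filter, hmem, stage, leftover]
    grind (splits := 40)
  have htrail := isTrail_trail (N := 6 * i - 1) (3 * i - 1) (by omega)
  have hm : 2 * ((3 * i - 1 : ℕ) : ℤ) = 6 * i - 2 := by omega
  rw [hm] at htrail
  obtain ⟨R, hsweep, hR⟩ := exists_sweepFrom (B := B) (trail (3 * i - 1)) (0, 0)
    (B \ B.filter (stage (6 * i - 1) 0)) htrail.dirs (by simp) ((hP 0 0).2 (by simp))
    (by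
      rintro ⟨x, y⟩ hz hz2
      rw [hP] at hz
      rcases hz with h | h
      exacts [Prod.ext h.1 h.2, absurd hz2 h.2.2])
    htrail.nodup
    (by
      rintro ⟨x, y⟩ hz
      exact (hP x y).2 (.inr ((htrail.mem_mids _).1 hz)))
    (by
      rintro ⟨x, y⟩ hz
      exact (hmem x y).2 (htrail.holes _ hz))
  have hlen : (trail (3 * i - 1)).length = (9 * i - 1) * (3 * i - 1) := by
    rw [length_trail]; congr 1; omega
  have hne : trail (3 * i - 1) ≠ [] := by
    rw [← List.length_pos_iff, hlen]
    exact Nat.mul_pos (by omega) (by omega)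
  obtain ⟨ms, hms⟩ := exists_plays_append hreach
    (.cons (m := ((0, 0), trail (3 * i - 1))) ⟨hne, _, hsweep⟩ (.nil R))
  refine ⟨_, Finset.singleton_subset_iff.1 hvB, ms, _, R, hms, ?_, hlen⟩
  rw [Finset.card_eq_one]
  refine ⟨sweepEnd (0, 0) (trail (3 * i - 1)), ?_⟩
  ext ⟨x, y⟩
  rw [hR, Finset.mem_singleton, htrail.mem_mids, hP, or_iff_left]
  rintro ⟨h | h, h1, h2⟩
  exacts [h1 (Prod.ext h.1 h.2), h2 h]
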